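/- Let α ≥ 0, α ≠ 1, and β ≠ 1 be real, let p, q ∈ P_n, and let r ∈ P_n satisfy Σ_{i=1}^k r_i = min(Σ_{i=1}^k p_i, Σ_{i=1}^k q_i) for all k = 1, …, n (so r = p ∧ q is the greatest lower bound of p and q in the majorization lattice). Then S_{α,β}(r) ≤ S_{α,β}(p) + S_{α,β}(q) + (1 − β) · S_{α,β}(p) · S_{α,β}(q). -/

import Mathlib

open Finset Real

/-- `p` is a probability vector: nonnegative, non-increasing entries summing to 1. -/
def IsProbVec {n : ℕ} (p : Fin n → ℝ) : Prop :=
  (∀ i, 0 ≤ p i) ∧ (∀ i j : Fin n, i ≤ j → p j ≤ p i) ∧ ∑ i, p i = 1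

/-- The sum of the first `k` entries of `p`. -/
noncomputable def partialSum {n : ℕ} (p : Fin n → ℝ) (k : ℕ) : ℝ :=
  ∑ i : Fin n, if (i : ℕ) < k then p i else 0

/-- `p` is majorized by `q` (`p ⪯ q`). -/
def MajorizedBy {n : ℕ} (p q : Fin n → ℝ) : Prop :=
  ∀ k : ℕ, k ≤ n → partialSum p k ≤ partialSum q k

/-- The Sharma–Mittal entropy of order `(α, β)`. -/
noncomputable def sharmaMittal (α β : ℝ) {n : ℕ} (p : Fin n → ℝ) : ℝ :=
  (1 / (1 - β)) * ((∑ i, p i ^ α) ^ ((1 - β) / (1 - α)) - 1)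

open MeasureTheory Set in
/-- `x ^ a`, for `0 < a < 1`, as a mixture of the concave functions `x ↦ min x t`. -/
lemma integrableOn_and_integral_min_mul_rpow {a x : ℝ} (ha0 : 0 < a) (ha1 : a < 1) (hx : 0 ≤ x) :
    IntegrableOn (fun t : ℝ => min x t * t ^ (a - 2)) (Ioi 0) ∧
      ∫ t in Ioi (0 : ℝ), min x t * t ^ (a - 2) = (1 / a + 1 / (1 - a)) * x ^ a := by
  rcases hx.eq_or_lt with rfl | hx
  · have h : EqOn (fun t : ℝ => min 0 t * t ^ (a - 2)) (fun _ => 0) (Ioi 0) := by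
      intro t ht
      simp [min_eq_left (le_of_lt (mem_Ioi.1 ht))]
    refine ⟨(integrableOn_congr_fun h measurableSet_Ioi).2 integrableOn_zero, ?_⟩
    rw [setIntegral_congr_fun measurableSet_Ioi h, zero_rpow ha0.ne']
    simp
  have h1 : EqOn (fun t : ℝ => min x t * t ^ (a - 2)) (fun t => t ^ (a - 1)) (Ioc 0 x) := by
    intro t ht
    simp only
    rw [min_eq_right ht.2, show a - 1 = 1 + (a - 2) by ring, rpow_add ht.1, rpow_one]
  have h2 : EqOn (fun t : ℝ => min x t * t ^ (a - 2)) (fun t => x * t ^ (a - 2)) (Ioi x) := by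
    intro t ht
    simp only
    rw [min_eq_left (le_of_lt (mem_Ioi.1 ht))]
  have i1 : IntegrableOn (fun t : ℝ => min x t * t ^ (a - 2)) (Ioc 0 x) := by
    rw [integrableOn_congr_fun h1 measurableSet_Ioc,
      ← intervalIntegrable_iff_integrableOn_Ioc_of_le hx.le]
    exact intervalIntegral.intervalIntegrable_rpow' (by linarith)
  have i2 : IntegrableOn (fun t : ℝ => min x t * t ^ (a - 2)) (Ioi x) := by
    rw [integrableOn_congr_fun h2 measurableSet_Ioi]
    exact (integrableOn_Ioi_rpow_of_lt (by linarith) hx).const_mul x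
  have hu : Ioi (0 : ℝ) = Ioc 0 x ∪ Ioi x := (Ioc_union_Ioi_eq_Ioi hx.le).symm
  rw [hu]
  refine ⟨i1.union i2, ?_⟩
  rw [setIntegral_union (Ioc_disjoint_Ioi le_rfl) measurableSet_Ioi i1 i2,
    setIntegral_congr_fun measurableSet_Ioc h1, setIntegral_congr_fun measurableSet_Ioi h2,
    ← intervalIntegral.integral_of_le hx.le, integral_rpow (Or.inl (by linarith)),
    integral_const_mul, integral_Ioi_rpow_of_lt (by linarith) hx]
  have e : x ^ a = x * x ^ (a - 1) := by
    conv_lhs => rw [show a = 1 + (a - 1) by ring, rpow_add hx, rpow_one]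
  have e1 : a - 2 + 1 = -(1 - a) := by ring
  have e2 : a - 1 = -(1 - a) := by ring
  rw [sub_add_cancel, zero_rpow ha0.ne', e1, e, e2]
  have : 1 - a ≠ 0 := by linarith
  field_simp
  ring

open MeasureTheory Set in
/-- `x ^ a`, for `1 < a`, as a mixture of the convex functions `x ↦ max (x - t) 0`. -/
lemma integrableOn_and_integral_max_sub_mul_rpow {a x : ℝ} (ha : 1 < a) (hx : 0 ≤ x) :
    IntegrableOn (fun t : ℝ => max (x - t) 0 * t ^ (a - 2)) (Ioi 0) ∧
      ∫ t in Ioi (0 : ℝ), max (x - t) 0 * t ^ (a - 2) = (1 / (a - 1) - 1 / a) * x ^ a := by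
  have h1 : EqOn (fun t : ℝ => max (x - t) 0 * t ^ (a - 2))
      (fun t => x * t ^ (a - 2) - t ^ (a - 1)) (Ioc 0 x) := by
    intro t ht
    simp only
    rw [max_eq_left (sub_nonneg.2 ht.2), show a - 1 = 1 + (a - 2) by ring, rpow_add ht.1,
      rpow_one, sub_mul]
  have h2 : EqOn (fun t : ℝ => max (x - t) 0 * t ^ (a - 2)) (fun _ => 0) (Ioi x) := by
    intro t ht
    simp only
    rw [max_eq_right (sub_nonpos.2 (le_of_lt (mem_Ioi.1 ht))), zero_mul]
  have j1 : IntervalIntegrable (fun t : ℝ => x * t ^ (a - 2)) volume 0 x :=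
    (intervalIntegral.intervalIntegrable_rpow' (by linarith)).const_mul x
  have j2 : IntervalIntegrable (fun t : ℝ => t ^ (a - 1)) volume 0 x :=
    intervalIntegral.intervalIntegrable_rpow' (by linarith)
  have i1 : IntegrableOn (fun t : ℝ => max (x - t) 0 * t ^ (a - 2)) (Ioc 0 x) := by
    rw [integrableOn_congr_fun h1 measurableSet_Ioc,
      ← intervalIntegrable_iff_integrableOn_Ioc_of_le hx]
    exact j1.sub j2
  have i2 : IntegrableOn (fun t : ℝ => max (x - t) 0 * t ^ (a - 2)) (Ioi x) := by
    rw [integrableOn_congr_fun h2 measurableSet_Ioi]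
    exact integrableOn_zero
  have hu : Ioi (0 : ℝ) = Ioc 0 x ∪ Ioi x := (Ioc_union_Ioi_eq_Ioi hx).symm
  rw [hu]
  refine ⟨i1.union i2, ?_⟩
  rw [setIntegral_union (Ioc_disjoint_Ioi le_rfl) measurableSet_Ioi i1 i2,
    setIntegral_congr_fun measurableSet_Ioc h1, setIntegral_congr_fun measurableSet_Ioi h2,
    ← intervalIntegral.integral_of_le hx, intervalIntegral.integral_sub j1 j2,
    intervalIntegral.integral_const_mul, integral_rpow (Or.inl (by linarith)),
    integral_rpow (Or.inl (by linarith))]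
  have e : x ^ a = x * x ^ (a - 1) := by
    conv_lhs => rw [show a = 1 + (a - 1) by ring,
      rpow_add_of_nonneg hx zero_le_one (by linarith), rpow_one]
  have e1 : a - 2 + 1 = a - 1 := by ring
  rw [sub_add_cancel, zero_rpow (by linarith : a ≠ 0), e1, zero_rpow (by linarith : a - 1 ≠ 0), e]
  simp
  ring

section HingeOrder

variable {ι κ : Type*} [Fintype ι] [Fintype κ] {u : ι → ℝ} {v : κ → ℝ}

open MeasureTheory Set in
/-- A Karamata-type inequality for the power functions `x ↦ x ^ a` with `1 < a`. -/
lemma sum_rpow_le_sum_rpow_of_sum_max_sub_le {a : ℝ} (ha : 1 < a) (hu : ∀ i, 0 ≤ u i)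
    (hv : ∀ j, 0 ≤ v j)
    (h : ∀ t : ℝ, 0 < t → ∑ i, max (u i - t) 0 ≤ ∑ j, max (v j - t) 0) :
    ∑ i, u i ^ a ≤ ∑ j, v j ^ a := by
  have Iu := fun i => integrableOn_and_integral_max_sub_mul_rpow ha (hu i)
  have Iv := fun j => integrableOn_and_integral_max_sub_mul_rpow ha (hv j)
  have hc : 0 < 1 / (a - 1) - 1 / a :=
    sub_pos.2 (one_div_lt_one_div_of_lt (by linarith) (by linarith))
  refine le_of_mul_le_mul_left ?_ hc
  rw [Finset.mul_sum, Finset.mul_sum]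
  simp_rw [← fun i => (Iu i).2, ← fun j => (Iv j).2]
  rw [← integral_finsetSum _ fun i _ => (Iu i).1, ← integral_finsetSum _ fun j _ => (Iv j).1]
  refine setIntegral_mono_on (integrable_finsetSum _ fun i _ => (Iu i).1)
    (integrable_finsetSum _ fun j _ => (Iv j).1) measurableSet_Ioi fun t ht => ?_
  rw [← Finset.sum_mul, ← Finset.sum_mul]
  exact mul_le_mul_of_nonneg_right (h t ht) (rpow_nonneg (le_of_lt ht) _)

open MeasureTheory Set in
/-- A Karamata-type inequality for the power functions `x ↦ x ^ a` with `0 < a < 1`. -/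
lemma sum_rpow_le_sum_rpow_of_sum_min_le {a : ℝ} (ha0 : 0 < a) (ha1 : a < 1)
    (hu : ∀ i, 0 ≤ u i) (hv : ∀ j, 0 ≤ v j)
    (h : ∀ t : ℝ, 0 < t → ∑ i, min (u i) t ≤ ∑ j, min (v j) t) :
    ∑ i, u i ^ a ≤ ∑ j, v j ^ a := by
  have Iu := fun i => integrableOn_and_integral_min_mul_rpow ha0 ha1 (hu i)
  have Iv := fun j => integrableOn_and_integral_min_mul_rpow ha0 ha1 (hv j)
  have hc : 0 < 1 / a + 1 / (1 - a) :=
    add_pos (one_div_pos.2 ha0) (one_div_pos.2 (sub_pos.2 ha1))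
  refine le_of_mul_le_mul_left ?_ hc
  rw [Finset.mul_sum, Finset.mul_sum]
  simp_rw [← fun i => (Iu i).2, ← fun j => (Iv j).2]
  rw [← integral_finsetSum _ fun i _ => (Iu i).1, ← integral_finsetSum _ fun j _ => (Iv j).1]
  refine setIntegral_mono_on (integrable_finsetSum _ fun i _ => (Iu i).1)
    (integrable_finsetSum _ fun j _ => (Iv j).1) measurableSet_Ioi fun t ht => ?_
  rw [← Finset.sum_mul, ← Finset.sum_mul]
  exact mul_le_mul_of_nonneg_right (h t ht) (rpow_nonneg (le_of_lt ht) _)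

end HingeOrder

/-- The partial sums of a probability vector are the largest sums over sets of given size. -/
lemma IsProbVec.sum_le_partialSum {n : ℕ} {p : Fin n → ℝ} (hp : IsProbVec p) {s : Finset (Fin n)}
    {k : ℕ} (hs : s.card ≤ k) (hk : k ≤ n) : ∑ i ∈ s, p i ≤ partialSum p k := by
  obtain ⟨h0, hanti, -⟩ := hp
  rcases k.eq_zero_or_pos with rfl | hk0
  · simp [Finset.card_eq_zero.1 (Nat.le_zero.1 hs), partialSum]
  set c := p ⟨k - 1, by omega⟩ with hc
  have hcard : ((Finset.univ.filter fun i : Fin n => (i : ℕ) < k).card : ℝ) = k := by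
    rw [Fin.card_filter_val_lt, min_eq_right hk]
  have hsum : ∑ i ∈ s, (p i - c) ≤ ∑ i : Fin n, if (i : ℕ) < k then p i - c else 0 := by
    rw [← Finset.univ_inter s, ← Finset.sum_ite_mem]
    refine Finset.sum_le_sum fun i _ => ?_
    by_cases hi : (i : ℕ) < k
    · have : c ≤ p i := hanti _ _ (Fin.le_def.2 (by simp; omega))
      split_ifs <;> linarith
    · have : p i ≤ c := hanti _ _ (Fin.le_def.2 (by simp; omega))
      split_ifs <;> linarith
  rw [← Finset.sum_filter, Finset.sum_sub_distrib, Finset.sum_sub_distrib, Finset.sum_const,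
    Finset.sum_const, nsmul_eq_mul, nsmul_eq_mul, hcard, Finset.sum_filter] at hsum
  have : (s.card : ℝ) * c ≤ k * c :=
    mul_le_mul_of_nonneg_right (by exact_mod_cast hs) (h0 _)
  rw [partialSum]
  linarith

/-- Sums of entries of a product of probability vectors are bounded by sums over the projection. -/
lemma sum_mul_le_sum_image {ι κ τ : Type*} [DecidableEq ι] [Fintype κ] [DecidableEq τ]
    {p : ι → ℝ} {q : κ → ℝ} (hp : ∀ i, 0 ≤ p i) (hq : ∀ j, 0 ≤ q j) (hq1 : ∑ j, q j = 1)
    (T : Finset τ) (f : τ → ι) (g : τ → κ) (hfg : Function.Injective fun x => (f x, g x)) :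
    ∑ x ∈ T, p (f x) * q (g x) ≤ ∑ i ∈ T.image f, p i := by
  classical
  calc ∑ x ∈ T, p (f x) * q (g x)
      = ∑ y ∈ T.image (fun x => (f x, g x)), p y.1 * q y.2 :=
        (Finset.sum_image (f := fun y : ι × κ => p y.1 * q y.2) hfg.injOn).symm
    _ ≤ ∑ y ∈ T.image f ×ˢ Finset.univ, p y.1 * q y.2 := by
        refine Finset.sum_le_sum_of_subset_of_nonneg (fun y hy => ?_)
          fun y _ _ => mul_nonneg (hp _) (hq _)
        obtain ⟨x, hx, rfl⟩ := Finset.mem_image.1 hy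
        simpa using ⟨x, hx, rfl⟩
    _ = ∑ i ∈ T.image f, p i := by
        rw [Finset.sum_product]
        simp_rw [← Finset.mul_sum, hq1, mul_one]

/-- The product `p ⊗ q` is majorized by `p ∧ q`, expressed through hinge functions. -/
lemma sum_max_mul_sub_le_of_glb {n : ℕ} {p q r : Fin n → ℝ} (hp : IsProbVec p)
    (hq : IsProbVec q)
    (hglb : ∀ k : ℕ, k ≤ n → partialSum r k = min (partialSum p k) (partialSum q k))
    {t : ℝ} (ht : 0 < t) :
    ∑ x : Fin n × Fin n, max (p x.1 * q x.2 - t) 0 ≤ ∑ i, max (r i - t) 0 := by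
  classical
  set T := Finset.univ.filter fun x : Fin n × Fin n => t < p x.1 * q x.2 with hT
  set k := min T.card n with hk
  have hkn : k ≤ n := min_le_right _ _
  have hcard (f : Fin n × Fin n → Fin n) : (T.image f).card ≤ k :=
    le_min Finset.card_image_le ((Finset.card_le_univ _).trans_eq (Fintype.card_fin n))
  have hTr : ∑ x ∈ T, p x.1 * q x.2 ≤ partialSum r k := by
    rw [hglb k hkn]
    refine le_min ?_ ?_
    · exact (sum_mul_le_sum_image hp.1 hq.1 hq.2.2 T Prod.fst Prod.snd
        fun x y h => h).trans (hp.sum_le_partialSum (hcard _) hkn)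
    · simp_rw [fun x : Fin n × Fin n => mul_comm (p x.1) (q x.2)]
      exact (sum_mul_le_sum_image hq.1 hp.1 hp.2.2 T Prod.snd Prod.fst
        fun x y h => Prod.swap_injective h).trans (hq.sum_le_partialSum (hcard _) hkn)
  have hleft : ∑ x : Fin n × Fin n, max (p x.1 * q x.2 - t) 0
      = ∑ x ∈ T, p x.1 * q x.2 - T.card * t := by
    rw [← nsmul_eq_mul, ← Finset.sum_const, ← Finset.sum_sub_distrib, hT, Finset.sum_filter]
    refine Finset.sum_congr rfl fun x _ => ?_
    split_ifs with h
    · exact max_eq_left (by linarith)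
    · exact max_eq_right (by linarith)
  have hright : partialSum r k - k * t ≤ ∑ i, max (r i - t) 0 := by
    have hc : ((Finset.univ.filter fun i : Fin n => (i : ℕ) < k).card : ℝ) = k := by
      rw [Fin.card_filter_val_lt, min_eq_right hkn]
    rw [partialSum, ← hc, ← nsmul_eq_mul, ← Finset.sum_const, ← Finset.sum_filter,
      ← Finset.sum_sub_distrib, Finset.sum_filter]
    refine Finset.sum_le_sum fun i _ => ?_
    split_ifs
    · exact le_max_left _ _
    · exact le_max_right _ _
  have hkT : (k : ℝ) * t ≤ T.card * t :=
    mul_le_mul_of_nonneg_right (by exact_mod_cast min_le_left _ _) ht.le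
  linarith

lemma sum_mul_rpow {n : ℕ} {p q : Fin n → ℝ} (hp : ∀ i, 0 ≤ p i) (hq : ∀ i, 0 ≤ q i) (a : ℝ) :
    ∑ x : Fin n × Fin n, (p x.1 * q x.2) ^ a = (∑ i, p i ^ a) * ∑ i, q i ^ a := by
  rw [Finset.sum_mul_sum, Fintype.sum_prod_type]
  exact Finset.sum_congr rfl fun i _ => Finset.sum_congr rfl fun j _ => mul_rpow (hp i) (hq j)

lemma IsProbVec.sum_rpow_pos {n : ℕ} {p : Fin n → ℝ} (hp : IsProbVec p) (a : ℝ) :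
    0 < ∑ i, p i ^ a := by
  obtain ⟨i, -, hi⟩ := Finset.exists_ne_zero_of_sum_ne_zero (hp.2.2.trans_ne one_ne_zero)
  exact Finset.sum_pos' (fun j _ => rpow_nonneg (hp.1 j) a)
    ⟨i, Finset.mem_univ i, rpow_pos_of_pos ((hp.1 i).lt_of_ne' hi) a⟩

lemma sum_rpow_mul_sum_rpow_le_of_glb {n : ℕ} {a : ℝ} (ha : 1 < a) {p q r : Fin n → ℝ}
    (hp : IsProbVec p) (hq : IsProbVec q) (hr : IsProbVec r)
    (hglb : ∀ k : ℕ, k ≤ n → partialSum r k = min (partialSum p k) (partialSum q k)) :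
    (∑ i, p i ^ a) * ∑ i, q i ^ a ≤ ∑ i, r i ^ a := by
  rw [← sum_mul_rpow hp.1 hq.1]
  exact sum_rpow_le_sum_rpow_of_sum_max_sub_le ha (fun x => mul_nonneg (hp.1 _) (hq.1 _)) hr.1
    fun t ht => sum_max_mul_sub_le_of_glb hp hq hglb ht

lemma sum_rpow_le_sum_rpow_mul_of_glb {n : ℕ} {a : ℝ} (ha0 : 0 ≤ a) (ha1 : a < 1)
    {p q r : Fin n → ℝ} (hp : IsProbVec p) (hq : IsProbVec q) (hr : IsProbVec r)
    (hglb : ∀ k : ℕ, k ≤ n → partialSum r k = min (partialSum p k) (partialSum q k)) :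
    ∑ i, r i ^ a ≤ (∑ i, p i ^ a) * ∑ i, q i ^ a := by
  rcases ha0.eq_or_lt with rfl | ha0
  · simp only [rpow_zero, Finset.sum_const, Finset.card_univ, Fintype.card_fin, nsmul_eq_mul,
      mul_one]
    exact_mod_cast Nat.le_mul_self n
  rw [← sum_mul_rpow hp.1 hq.1]
  refine sum_rpow_le_sum_rpow_of_sum_min_le ha0 ha1 hr.1
    (fun x => mul_nonneg (hp.1 _) (hq.1 _)) fun t ht => ?_
  have hmin (x : ℝ) : min x t = x - max (x - t) 0 := by
    rcases le_total x t with h | h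
    · rw [min_eq_left h, max_eq_right (sub_nonpos.2 h), sub_zero]
    · rw [min_eq_right h, max_eq_left (sub_nonneg.2 h), sub_sub_cancel]
  have hprod : ∑ x : Fin n × Fin n, p x.1 * q x.2 = 1 := by
    simpa [hp.2.2, hq.2.2] using sum_mul_rpow hp.1 hq.1 1
  simp_rw [hmin, Finset.sum_sub_distrib, hprod, hr.2.2]
  linarith [sum_max_mul_sub_le_of_glb hp hq hglb ht]

/-- For `α ≥ 0`, `α ≠ 1`, `β ≠ 1`, the Sharma–Mittal entropy of the greatest lower
bound `r = p ∧ q` satisfies `S(r) ≤ S(p) + S(q) + (1 - β) * S(p) * S(q)`. -/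
theorem sharmaMittal_glb_le {n : ℕ} (α β : ℝ) (hα0 : 0 ≤ α) (hα1 : α ≠ 1) (hβ1 : β ≠ 1)
    (p q r : Fin n → ℝ) (hp : IsProbVec p) (hq : IsProbVec q) (hr : IsProbVec r)
    (hglb : ∀ k : ℕ, k ≤ n → partialSum r k = min (partialSum p k) (partialSum q k)) :
    sharmaMittal α β r ≤ sharmaMittal α β p + sharmaMittal α β q
      + (1 - β) * sharmaMittal α β p * sharmaMittal α β q := by
  set A := ∑ i, p i ^ α with hA
  set B := ∑ i, q i ^ α with hB
  set R := ∑ i, r i ^ α with hR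
  have hA0 : 0 < A := hp.sum_rpow_pos α
  have hB0 : 0 < B := hq.sum_rpow_pos α
  have hR0 : 0 < R := hr.sum_rpow_pos α
  have hβ : 1 - β ≠ 0 := sub_ne_zero.2 hβ1.symm
  have hrhs : sharmaMittal α β p + sharmaMittal α β q
      + (1 - β) * sharmaMittal α β p * sharmaMittal α β q
      = (1 / (1 - β)) * ((A * B) ^ ((1 - β) / (1 - α)) - 1) := by
    simp only [sharmaMittal, ← hA, ← hB]
    rw [mul_rpow hA0.le hB0.le]
    field_simp
    ring
  rw [hrhs]
  simp only [sharmaMittal, ← hR]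
  have main : (0 < 1 - β ∧ R ^ ((1 - β) / (1 - α)) ≤ (A * B) ^ ((1 - β) / (1 - α))) ∨
      (1 - β < 0 ∧ (A * B) ^ ((1 - β) / (1 - α)) ≤ R ^ ((1 - β) / (1 - α))) := by
    rcases hα1.lt_or_gt with hα | hα
    · have h := sum_rpow_le_sum_rpow_mul_of_glb hα0 hα hp hq hr hglb
      have hα' : 0 < 1 - α := sub_pos.2 hα
      rcases hβ.lt_or_gt with hb | hb
      · exact Or.inr ⟨hb, rpow_le_rpow_of_nonpos hR0 h (div_nonpos_of_nonpos_of_nonneg hb.le hα'.le)⟩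
      · exact Or.inl ⟨hb, rpow_le_rpow hR0.le h (div_nonneg hb.le hα'.le)⟩
    · have h := sum_rpow_mul_sum_rpow_le_of_glb hα hp hq hr hglb
      have hα' : 1 - α < 0 := sub_neg.2 hα
      rcases hβ.lt_or_gt with hb | hb
      · exact Or.inr ⟨hb, rpow_le_rpow (mul_pos hA0 hB0).le h (div_nonneg_of_nonpos hb.le hα'.le)⟩
      · exact Or.inl ⟨hb, rpow_le_rpow_of_nonpos (mul_pos hA0 hB0) h
          (div_nonpos_of_nonneg_of_nonpos hb.le hα'.le)⟩
  rcases main with ⟨hb, h⟩ | ⟨hb, h⟩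
  · exact mul_le_mul_of_nonneg_left (sub_le_sub_right h 1) (one_div_nonneg.2 hb.le)
  · exact mul_le_mul_of_nonpos_left (sub_le_sub_right h 1) (one_div_nonpos.2 hb.le)
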